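/- arXiv:math/0310306 — 3 statements merged into one kernel-verified Lean document; each statement's English description precedes it below -/
import Mathlib

section
/- Let f_l(x) = (π/2)·Σ_{k∈ℤ} (−1)^k (k+1/2) exp(−(π²/2)(k+1/2)²x) for x > 0. Then for every λ > 0, ∫₀^∞ e^{−λx} f_l(x) dx = 1/cosh√(2λ). -/
open MeasureTheory

/-- The density `f_l`. -/
noncomputable def fLen (x : ℝ) : ℝ :=
  (Real.pi / 2) * ∑' k : ℤ, (-1 : ℝ) ^ k * ((k : ℝ) + 1/2) *
    Real.exp (-(Real.pi ^ 2 / 2) * ((k : ℝ) + 1/2) ^ 2 * x)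

open Filter Topology

/-- The fundamental theorem of calculus on `(a, ∞)` for a nonnegative derivative, with a one-sided
limit at `a`. -/
theorem integrableOn_and_integral_Ioi_of_hasDerivAt_of_nonneg {g g' : ℝ → ℝ} {a l m : ℝ}
    (hderiv : ∀ x ∈ Set.Ioi a, HasDerivAt g (g' x) x) (hpos : ∀ x ∈ Set.Ioi a, 0 ≤ g' x)
    (hl : Tendsto g (𝓝[>] a) (𝓝 l)) (hm : Tendsto g atTop (𝓝 m)) :
    IntegrableOn g' (Set.Ioi a) ∧ ∫ x in Set.Ioi a, g' x = m - l := by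
  have hcont : ContinuousWithinAt (Function.update g a l) (Set.Ici a) a := by
    rw [continuousWithinAt_update_same, Set.Ici_sdiff_left]
    exact hl
  have hderiv' : ∀ x ∈ Set.Ioi a, HasDerivAt (Function.update g a l) (g' x) x := by
    intro x hx
    apply (hderiv x hx).congr_of_eventuallyEq
    filter_upwards [eventually_ne_nhds (ne_of_gt hx)] with y hy
    exact Function.update_of_ne hy l g
  have hm' : Tendsto (Function.update g a l) atTop (𝓝 m) := by
    refine hm.congr' ?_
    filter_upwards [eventually_ne_atTop a] with y hy
    exact (Function.update_of_ne hy l g).symm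
  refine ⟨integrableOn_Ioi_deriv_of_nonneg hcont hderiv' hpos hm', ?_⟩
  rw [integral_Ioi_of_hasDerivAt_of_nonneg hcont hderiv' hpos hm', Function.update_self]

/-- The odd primitive of the Gaussian `t ↦ exp (-t² / 2)`. -/
noncomputable def gaussPrimitive (y : ℝ) : ℝ := ∫ t in (0 : ℝ)..y, Real.exp (-(1 / 2) * t ^ 2)

theorem hasDerivAt_gaussPrimitive (y : ℝ) :
    HasDerivAt gaussPrimitive (Real.exp (-(1 / 2) * y ^ 2)) y := by
  have hc : Continuous fun t : ℝ => Real.exp (-(1 / 2) * t ^ 2) := by fun_prop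
  exact intervalIntegral.integral_hasDerivAt_right (hc.intervalIntegrable _ _)
    (hc.stronglyMeasurableAtFilter _ _) hc.continuousAt

theorem gaussPrimitive_neg (y : ℝ) : gaussPrimitive (-y) = -gaussPrimitive y := by
  have h := intervalIntegral.integral_comp_neg (a := 0) (b := y)
    (fun t : ℝ => Real.exp (-(1 / 2) * t ^ 2))
  simp only [neg_sq, neg_zero] at h
  rw [gaussPrimitive, gaussPrimitive, h, intervalIntegral.integral_symm]

theorem tendsto_gaussPrimitive_atTop :
    Tendsto gaussPrimitive atTop (𝓝 (√(2 * Real.pi) / 2)) := by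
  have h := intervalIntegral_tendsto_integral_Ioi (μ := volume) (0 : ℝ)
    (integrable_exp_neg_mul_sq (b := 1 / 2) (by norm_num)).integrableOn tendsto_id
  rw [integral_gaussian_Ioi, show Real.pi / (1 / 2) = 2 * Real.pi by ring] at h
  exact h

theorem tendsto_gaussPrimitive_atBot :
    Tendsto gaussPrimitive atBot (𝓝 (-(√(2 * Real.pi) / 2))) := by
  have h := (tendsto_gaussPrimitive_atTop.comp tendsto_neg_atBot_atTop).neg
  refine h.congr fun y => ?_
  simp [gaussPrimitive_neg]

/-- The Laplace transform of the (unnormalised) Lévy density. -/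
theorem integrableOn_and_integral_levy {a lam : ℝ} (ha : 0 < a) (hlam : 0 < lam) :
    IntegrableOn (fun x : ℝ => Real.exp (-lam * x) *
        (a * Real.exp (-(a ^ 2 / (2 * x))) / (x * √x))) (Set.Ioi 0) ∧
      ∫ x in Set.Ioi (0 : ℝ), Real.exp (-lam * x) *
        (a * Real.exp (-(a ^ 2 / (2 * x))) / (x * √x)) =
        √(2 * Real.pi) * Real.exp (-a * √(2 * lam)) := by
  set s := √(2 * lam) with hs
  have hs0 : 0 < s := Real.sqrt_pos.2 (by positivity)
  have hs2 : s ^ 2 = 2 * lam := Real.sq_sqrt (by positivity)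
  have hsqrt0 : Tendsto Real.sqrt (𝓝[>] 0) (𝓝[>] 0) := by
    refine tendsto_nhdsWithin_iff.2 ⟨?_, ?_⟩
    · have := (Real.continuous_sqrt.tendsto 0)
      rw [Real.sqrt_zero] at this
      exact this.mono_left nhdsWithin_le_nhds
    · filter_upwards [self_mem_nhdsWithin] with x hx using Real.sqrt_pos.2 hx
  have hdiv0 : Tendsto (fun x => -(a / √x)) (𝓝[>] 0) atBot := by
    simp only [div_eq_mul_inv]
    exact tendsto_neg_atTop_atBot.comp
      ((tendsto_inv_nhdsGT_zero.comp hsqrt0).const_mul_atTop ha)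
  have hdivTop : Tendsto (fun x => -(a / √x)) atTop (𝓝 0) := by
    simpa using (tendsto_const_nhds.div_atTop Real.tendsto_sqrt_atTop).neg
  have hlin0 : ∀ c : ℝ, Tendsto (fun x => c * √x) (𝓝[>] 0) (𝓝 0) := by
    intro c
    simpa using (hsqrt0.mono_right nhdsWithin_le_nhds).const_mul c
  have hderiv : ∀ x ∈ Set.Ioi (0 : ℝ), HasDerivAt
      (fun x => Real.exp (-a * s) * gaussPrimitive (s * √x + -(a / √x)) +
        Real.exp (a * s) * gaussPrimitive (-s * √x + -(a / √x)))
      (Real.exp (-lam * x) * (a * Real.exp (-(a ^ 2 / (2 * x))) / (x * √x))) x := by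
    intro x hx
    have hx : 0 < x := hx
    have hr : 0 < √x := Real.sqrt_pos.2 hx
    have hrx : √x ^ 2 = x := Real.sq_sqrt hx.le
    have hd := Real.hasDerivAt_sqrt hx.ne'
    have hdiv := (hd.fun_inv hr.ne').const_mul a
    simp only [← div_eq_mul_inv] at hdiv
    have h1 := ((hasDerivAt_gaussPrimitive _).comp x
      ((hd.const_mul s).add hdiv.neg)).const_mul (Real.exp (-a * s))
    have h2 := ((hasDerivAt_gaussPrimitive _).comp x
      ((hd.const_mul (-s)).add hdiv.neg)).const_mul (Real.exp (a * s))
    refine (h1.add h2).congr_deriv ?_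
    have e1 : Real.exp (-a * s) * Real.exp (-(1 / 2) * (s * √x + -(a / √x)) ^ 2) =
        Real.exp (-lam * x) * Real.exp (-(a ^ 2 / (2 * x))) := by
      rw [← Real.exp_add, ← Real.exp_add]
      congr 1
      have : lam = s ^ 2 / 2 := by linarith
      rw [this, ← hrx, Real.sqrt_sq hr.le]
      field_simp
      ring
    have e2 : Real.exp (a * s) * Real.exp (-(1 / 2) * (-s * √x + -(a / √x)) ^ 2) =
        Real.exp (-lam * x) * Real.exp (-(a ^ 2 / (2 * x))) := by
      rw [← Real.exp_add, ← Real.exp_add]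
      congr 1
      have : lam = s ^ 2 / 2 := by linarith
      rw [this, ← hrx, Real.sqrt_sq hr.le]
      field_simp
      ring
    simp only [Pi.add_apply, Pi.neg_apply]
    rw [← mul_assoc, ← mul_assoc, e1, e2]
    rw [hrx]
    field_simp
    ring
  have hpos : ∀ x ∈ Set.Ioi (0 : ℝ),
      0 ≤ Real.exp (-lam * x) * (a * Real.exp (-(a ^ 2 / (2 * x))) / (x * √x)) := by
    intro x hx
    have hx : 0 < x := hx
    positivity
  have hl := ((tendsto_gaussPrimitive_atBot.comp ((hlin0 s).add_atBot hdiv0)).const_mul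
    (Real.exp (-a * s))).add ((tendsto_gaussPrimitive_atBot.comp
      ((hlin0 (-s)).add_atBot hdiv0)).const_mul (Real.exp (a * s)))
  have hm := ((tendsto_gaussPrimitive_atTop.comp
    ((Real.tendsto_sqrt_atTop.const_mul_atTop hs0).atTop_add hdivTop)).const_mul
    (Real.exp (-a * s))).add ((tendsto_gaussPrimitive_atBot.comp
      ((Real.tendsto_sqrt_atTop.const_mul_atTop_of_neg (neg_neg_of_pos hs0)).atBot_add
        hdivTop)).const_mul (Real.exp (a * s)))
  obtain ⟨h1, h2⟩ := integrableOn_and_integral_Ioi_of_hasDerivAt_of_nonneg hderiv hpos hl hm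
  exact ⟨h1, by rw [h2]; ring⟩

theorem HasSum.int_even_add_odd {M : Type*} [AddCommMonoid M] [TopologicalSpace M]
    [ContinuousAdd M] {f : ℤ → M} {m m' : M} (he : HasSum (fun k : ℤ => f (2 * k)) m)
    (ho : HasSum (fun k : ℤ => f (2 * k + 1)) m') : HasSum f (m + m') := by
  have h := mul_right_injective₀ (two_ne_zero' ℤ)
  replace ho := ((add_left_injective 1).comp h).hasSum_range_iff.2 ho
  refine (h.hasSum_range_iff.2 he).add_isCompl ?_ ho
  have hr : Set.range (fun n : ℤ => 2 * n) = {n | Even n} := by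
    ext n
    simp [even_iff_exists_two_mul]
  have hr' : Set.range ((fun n : ℤ => n + 1) ∘ fun n : ℤ => 2 * n) = {n | Odd n} := by
    ext n
    simp only [Set.mem_range, Function.comp_apply, Set.mem_ofPred_eq, Odd, eq_comm]
  rw [hr, hr']
  exact Int.isCompl_even_odd

theorem fLen_eq_oddKernel {x : ℝ} (hx : 0 < x) :
    fLen x = 2 * Real.pi * HurwitzZeta.oddKernel ((1 / 4 : ℝ) : UnitAddCircle)
      (2 * Real.pi * x) := by
  have h := HurwitzZeta.hasSum_int_oddKernel (1 / 4) (x := 2 * Real.pi * x) (by positivity)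
  have he : HasSum (fun k : ℤ => (-1 : ℝ) ^ (2 * k) * (((2 * k : ℤ) : ℝ) + 1/2) *
      Real.exp (-(Real.pi ^ 2 / 2) * (((2 * k : ℤ) : ℝ) + 1/2) ^ 2 * x))
      (2 * HurwitzZeta.oddKernel ((1 / 4 : ℝ) : UnitAddCircle) (2 * Real.pi * x)) := by
    refine (h.mul_left 2).congr_fun fun k => ?_
    rw [(even_two_mul k).neg_one_zpow, ← mul_assoc]
    push_cast
    congr 1
    · ring
    · congr 1; ring
  have ho : HasSum (fun k : ℤ => (-1 : ℝ) ^ (2 * k + 1) * (((2 * k + 1 : ℤ) : ℝ) + 1/2) *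
      Real.exp (-(Real.pi ^ 2 / 2) * (((2 * k + 1 : ℤ) : ℝ) + 1/2) ^ 2 * x))
      (2 * HurwitzZeta.oddKernel ((1 / 4 : ℝ) : UnitAddCircle) (2 * Real.pi * x)) := by
    refine (((Equiv.subLeft (-1 : ℤ)).hasSum_iff.2 h).mul_left 2).congr_fun fun k => ?_
    rw [(odd_two_mul_add_one k).neg_one_zpow]
    simp only [Function.comp_apply, Equiv.subLeft_apply]
    rw [← mul_assoc]
    push_cast
    congr 1
    · ring
    · congr 1; ring
  rw [fLen, (HasSum.int_even_add_odd (f := fun k : ℤ => (-1 : ℝ) ^ k * ((k : ℝ) + 1/2) *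
    Real.exp (-(Real.pi ^ 2 / 2) * ((k : ℝ) + 1/2) ^ 2 * x)) he ho).tsum_eq]
  ring

theorem hasSum_fLen {x : ℝ} (hx : 0 < x) :
    HasSum (fun n : ℕ => 2 * Real.sin (Real.pi * n / 2) / √(2 * Real.pi) *
      (n * Real.exp (-((n : ℝ) ^ 2 / (2 * x))) / (x * √x))) (fLen x) := by
  rw [fLen_eq_oddKernel hx, HurwitzZeta.oddKernel_functional_equation, ← mul_assoc]
  refine ((HurwitzZeta.hasSum_nat_sinKernel (1 / 4)
    (t := 1 / (2 * Real.pi * x)) (by positivity)).mul_left _).congr_fun fun n => ?_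
  have hp : (2 * Real.pi * x) ^ (3 / 2 : ℝ) = 2 * Real.pi * x * (√(2 * Real.pi) * √x) := by
    rw [show (3 / 2 : ℝ) = 1 + 1 / 2 by norm_num, Real.rpow_add (by positivity), Real.rpow_one,
      ← Real.sqrt_eq_rpow, Real.sqrt_mul (by positivity)]
  have he : -Real.pi * (n : ℝ) ^ 2 * (1 / (2 * Real.pi * x)) = -((n : ℝ) ^ 2 / (2 * x)) := by
    field_simp
  have hsin : 2 * Real.pi * (1 / 4) * (n : ℝ) = Real.pi * n / 2 := by ring
  rw [hp, he, hsin]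
  field_simp

theorem hasSum_sin_mul_exp {s : ℝ} (hs : 0 < s) :
    HasSum (fun n : ℕ => 2 * Real.sin (Real.pi * n / 2) * Real.exp (-n * s))
      (1 / Real.cosh s) := by
  have he : HasSum (fun m : ℕ => 2 * Real.sin (Real.pi * (2 * m : ℕ) / 2) *
      Real.exp (-(2 * m : ℕ) * s)) 0 := by
    refine hasSum_zero.congr_fun fun m => ?_
    rw [show Real.pi * ((2 * m : ℕ) : ℝ) / 2 = m * Real.pi by push_cast; ring, Real.sin_nat_mul_pi]
    simp
  have hlt : Real.exp (-(2 * s)) < 1 := Real.exp_lt_one_iff.2 (by linarith)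
  have hgeo := hasSum_geometric_of_abs_lt_one (r := -Real.exp (-(2 * s)))
    (by rwa [abs_neg, Real.abs_exp])
  have ho : HasSum (fun m : ℕ => 2 * Real.sin (Real.pi * (2 * m + 1 : ℕ) / 2) *
      Real.exp (-(2 * m + 1 : ℕ) * s))
      (2 * Real.exp (-s) * (1 - -Real.exp (-(2 * s)))⁻¹) := by
    refine (hgeo.mul_left _).congr_fun fun m => ?_
    rw [show Real.pi * ((2 * m + 1 : ℕ) : ℝ) / 2 = Real.pi / 2 + m * Real.pi by push_cast; ring,
      Real.sin_add_nat_mul_pi, Real.sin_pi_div_two, neg_pow (Real.exp _), ← Real.exp_nat_mul,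
      show -((2 * m + 1 : ℕ) : ℝ) * s = -s + m * -(2 * s) by push_cast; ring, Real.exp_add]
    ring
  have hval : 1 / Real.cosh s = 0 + 2 * Real.exp (-s) * (1 - -Real.exp (-(2 * s)))⁻¹ := by
    rw [Real.cosh_eq, sub_neg_eq_add, show -(2 * s) = -s + -s by ring, Real.exp_add, Real.exp_neg]
    have := Real.exp_pos s
    field_simp
    ring
  rw [hval]
  exact HasSum.even_add_odd
    (f := fun n : ℕ => 2 * Real.sin (Real.pi * n / 2) * Real.exp (-n * s)) he ho

/-- For every `λ > 0`, `∫₀^∞ e^{−λx} f_l(x) dx = 1/cosh √(2λ)`. -/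
theorem statement10 (lam : ℝ) (hlam : 0 < lam) :
    ∫ x in Set.Ioi (0 : ℝ), Real.exp (-lam * x) * fLen x =
      1 / Real.cosh (Real.sqrt (2 * lam)) := by
  have hs0 : 0 < √(2 * lam) := Real.sqrt_pos.2 (by positivity)
  have hsum := hasSum_sin_mul_exp hs0
  have hpi : 0 < √(2 * Real.pi) := Real.sqrt_pos.2 (by positivity)
  set F : ℕ → ℝ → ℝ := fun n x => 2 * Real.sin (Real.pi * n / 2) / √(2 * Real.pi) *
    (Real.exp (-lam * x) * (n * Real.exp (-((n : ℝ) ^ 2 / (2 * x))) / (x * √x))) with hF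
  have hint : ∀ n, Integrable (F n) (volume.restrict (Set.Ioi 0)) := by
    intro n
    rcases n.eq_zero_or_pos with rfl | hn
    · simp [hF]
    · exact (integrableOn_and_integral_levy (Nat.cast_pos.2 hn) hlam).1.const_mul _
  have hval : ∀ n, ∫ x in Set.Ioi (0 : ℝ), F n x =
      2 * Real.sin (Real.pi * n / 2) * Real.exp (-n * √(2 * lam)) := by
    intro n
    rcases n.eq_zero_or_pos with rfl | hn
    · simp [hF]
    · rw [hF, integral_const_mul,
        (integrableOn_and_integral_levy (Nat.cast_pos.2 hn) hlam).2]
      field_simp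
  have hnorm : ∀ n, ∫ x in Set.Ioi (0 : ℝ), ‖F n x‖ =
      ‖2 * Real.sin (Real.pi * n / 2) * Real.exp (-n * √(2 * lam))‖ := by
    intro n
    rw [← hval, hF, integral_const_mul, norm_mul, Real.norm_of_nonneg
      (setIntegral_nonneg measurableSet_Ioi fun x (hx : 0 < x) => by positivity),
      ← integral_const_mul]
    refine setIntegral_congr_fun measurableSet_Ioi fun x (hx : 0 < x) => ?_
    rw [norm_mul, Real.norm_of_nonneg (by positivity : 0 ≤ Real.exp (-lam * x) * _)]
  have key := hasSum_integral_of_summable_integral_norm hint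
    (hsum.summable.norm.congr fun n => (hnorm n).symm)
  simp only [hval] at key
  rw [← key.unique hsum]
  refine setIntegral_congr_fun measurableSet_Ioi fun x (hx : 0 < x) => ?_
  refine (((hasSum_fLen hx).mul_left (Real.exp (-lam * x))).congr_fun fun n => ?_).tsum_eq.symm
  simp only [hF]
  ring
end

section
/- For z in the open unit disk D ⊂ ℂ, x ≥ 1 and y ≥ 0, define M(x,y,z) = (a(x,z) + b(x,z)·y)·e^{−y}, where a(x,z) = c₁(z)x^{λ₁(z)} + c₂(z)x^{λ₂(z)} and b(x,z) = c₁(z)(1 + λ₁(z)/(1−z))x^{λ₁(z)} + c₂(z)(1 + λ₂(z)/(1−z))x^{λ₂(z)}. Then for each fixed (x,y), the map z ↦ M(x,y,z) is analytic on D; writing M(x,y,z) = Σ_{k≥0} g(x,y,k)z^k, each coefficient g(·,·,k) is differentiable with respect to x and y on (1,∞)×(0,∞) with continuous partial derivatives, and ∂_xM(x,y,z) = Σ_{k≥0} ∂_xg(x,y,k)z^k and ∂_yM(x,y,z) = Σ_{k≥0} ∂_yg(x,y,k)z^k for all (x,y,z) ∈ (1,∞)×(0,∞)×D. -/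
open Set

/-- `λ₁(z) = (−3+√(5+4z))/2` (principal branch of the square root). -/
noncomputable def lam1 (z : ℂ) : ℂ := (-3 + (5 + 4 * z) ^ (1/2 : ℂ)) / 2

/-- `λ₂(z) = (−3−√(5+4z))/2`. -/
noncomputable def lam2 (z : ℂ) : ℂ := (-3 - (5 + 4 * z) ^ (1/2 : ℂ)) / 2

/-- `c₁(z)`. -/
noncomputable def cOne (z : ℂ) : ℂ := ((z - 1) / 3 - lam2 z) / (lam1 z - lam2 z)

/-- `c₂(z)`. -/
noncomputable def cTwo (z : ℂ) : ℂ := (-((z - 1) / 3) + lam1 z) / (lam1 z - lam2 z)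

/-- `a(x,z) = c₁(z)x^{λ₁(z)} + c₂(z)x^{λ₂(z)}`. -/
noncomputable def aFun (x : ℝ) (z : ℂ) : ℂ :=
  cOne z * (x : ℂ) ^ lam1 z + cTwo z * (x : ℂ) ^ lam2 z

/-- `b(x,z) = c₁(z)(1+λ₁(z)/(1−z))x^{λ₁(z)} + c₂(z)(1+λ₂(z)/(1−z))x^{λ₂(z)}`. -/
noncomputable def bFun (x : ℝ) (z : ℂ) : ℂ :=
  cOne z * (1 + lam1 z / (1 - z)) * (x : ℂ) ^ lam1 z +
    cTwo z * (1 + lam2 z / (1 - z)) * (x : ℂ) ^ lam2 z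

/-- `M(x,y,z) = (a(x,z) + b(x,z)y)e^{−y}`. -/
noncomputable def Mfun (x y : ℝ) (z : ℂ) : ℂ :=
  (aFun x z + bFun x z * (y : ℂ)) * Complex.exp (-(y : ℂ))

/-- Taylor coefficients at `0` of `h · exp(t l)` depend differentiably on `t`, and their derivatives
are the Taylor coefficients of `h l · exp(t l)`. -/
lemma hasDerivAt_iteratedDeriv_mul_exp {l : ℂ → ℂ} (hl : AnalyticAt ℂ l 0) (k : ℕ) :
    ∀ {h : ℂ → ℂ}, AnalyticAt ℂ h 0 → ∀ t : ℂ,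
      HasDerivAt (fun t => iteratedDeriv k (fun z => h z * Complex.exp (t * l z)) 0)
        (iteratedDeriv k (fun z => h z * l z * Complex.exp (t * l z)) 0) t := by
  have exp_an : ∀ t : ℂ, AnalyticAt ℂ (fun z => Complex.exp (t * l z)) 0 := fun t =>
    (analyticAt_const.mul hl).cexp
  have succ_eq : ∀ (k : ℕ) {h : ℂ → ℂ}, AnalyticAt ℂ h 0 → ∀ t : ℂ,
      iteratedDeriv (k + 1) (fun z => h z * Complex.exp (t * l z)) 0 =
        iteratedDeriv k (fun z => deriv h z * Complex.exp (t * l z)) 0 +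
          t * iteratedDeriv k (fun z => h z * deriv l z * Complex.exp (t * l z)) 0 := by
    intro k h hh t
    rw [iteratedDeriv_succ', ← iteratedDeriv_const_mul_field, ← iteratedDeriv_fun_add]
    · apply Filter.EventuallyEq.iteratedDeriv_eq
      filter_upwards [hh.eventually_analyticAt, hl.eventually_analyticAt] with z hz lz
      have := hz.differentiableAt.hasDerivAt.mul
        ((lz.differentiableAt.hasDerivAt.const_mul t).cexp)
      refine this.deriv.trans ?_
      ring
    · exact (hh.deriv.mul (exp_an t)).contDiffAt
    · exact (analyticAt_const.mul ((hh.mul hl.deriv).mul (exp_an t))).contDiffAt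
  induction k with
  | zero =>
    intro h _ t
    simp only [iteratedDeriv_zero]
    have := (((hasDerivAt_id t).mul_const (l 0)).cexp).const_mul (h 0)
    refine this.congr_deriv ?_
    simp only [id]
    ring
  | succ k ih =>
    intro h hh t
    rw [funext (succ_eq k hh), show (fun z => h z * l z * Complex.exp (t * l z)) =
      fun z => (h * l) z * Complex.exp (t * l z) from rfl, succ_eq k (hh.mul hl) t]
    have := (ih hh.deriv t).add ((hasDerivAt_id t).mul (ih (hh.mul hl.deriv) t))
    refine this.congr_deriv ?_
    have split : iteratedDeriv k (fun z => deriv (h * l) z * Complex.exp (t * l z)) 0 =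
        iteratedDeriv k (fun z => deriv h z * l z * Complex.exp (t * l z)) 0 +
          iteratedDeriv k (fun z => h z * deriv l z * Complex.exp (t * l z)) 0 := by
      rw [← iteratedDeriv_fun_add]
      · apply Filter.EventuallyEq.iteratedDeriv_eq
        filter_upwards [hh.eventually_analyticAt, hl.eventually_analyticAt] with z hz lz
        rw [deriv_mul hz.differentiableAt lz.differentiableAt]
        ring
      · exact ((hh.deriv.mul hl).mul (exp_an t)).contDiffAt
      · exact ((hh.mul hl.deriv).mul (exp_an t)).contDiffAt
    have swap : (fun z => h z * deriv l z * l z * Complex.exp (t * l z)) =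
        fun z => h z * l z * deriv l z * Complex.exp (t * l z) := by
      funext z
      ring
    change _ = iteratedDeriv k (fun z => deriv (h * l) z * Complex.exp (t * l z)) 0 +
      t * iteratedDeriv k (fun z => h z * l z * deriv l z * Complex.exp (t * l z)) 0
    rw [split, ← swap]
    simp only [id, Pi.mul_apply]
    ring

/-- The family `z ↦ f(x,z)`, `x > 0`, is analytic on the unit disk, with power-series coefficients
that are continuously differentiable in `x` and may be differentiated termwise. -/
def IsTermwiseDifferentiable (f : ℝ → ℂ → ℂ) : Prop :=
  (∀ x > 0, AnalyticOnNhd ℂ (f x) (Metric.ball 0 1)) ∧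
  ∃ (q q' : ℝ → ℕ → ℂ) (f' : ℝ → ℂ → ℂ),
    (∀ x > 0, ∀ z ∈ Metric.ball (0 : ℂ) 1, HasSum (fun k => q x k * z ^ k) (f x z)) ∧
    (∀ k, ∀ x > 0, HasDerivAt (fun x => q x k) (q' x k) x) ∧
    (∀ k, ContinuousOn (fun x => q' x k) (Ioi 0)) ∧
    (∀ x > 0, ∀ z ∈ Metric.ball (0 : ℂ) 1, HasDerivAt (fun x => f x z) (f' x z) x) ∧
    (∀ x > 0, ∀ z ∈ Metric.ball (0 : ℂ) 1, HasSum (fun k => q' x k * z ^ k) (f' x z))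

lemma IsTermwiseDifferentiable.add {f₁ f₂ : ℝ → ℂ → ℂ} (h₁ : IsTermwiseDifferentiable f₁)
    (h₂ : IsTermwiseDifferentiable f₂) :
    IsTermwiseDifferentiable (fun x z => f₁ x z + f₂ x z) := by
  obtain ⟨an₁, q₁, q₁', f₁', sum₁, dq₁, cont₁, df₁, sum₁'⟩ := h₁
  obtain ⟨an₂, q₂, q₂', f₂', sum₂, dq₂, cont₂, df₂, sum₂'⟩ := h₂
  refine ⟨fun x hx => (an₁ x hx).add (an₂ x hx), fun x k => q₁ x k + q₂ x k,
    fun x k => q₁' x k + q₂' x k, fun x z => f₁' x z + f₂' x z, ?_,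
    fun k x hx => (dq₁ k x hx).add (dq₂ k x hx), fun k => (cont₁ k).add (cont₂ k),
    fun x hx z hz => (df₁ x hx z hz).add (df₂ x hx z hz), ?_⟩
  · intro x hx z hz
    simpa only [add_mul] using (sum₁ x hx z hz).add (sum₂ x hx z hz)
  · intro x hx z hz
    simpa only [add_mul] using (sum₁' x hx z hz).add (sum₂' x hx z hz)

lemma hasDerivAt_clog_ofReal {x : ℝ} (hx : 0 < x) :
    HasDerivAt (fun x : ℝ => Complex.log x) (x : ℂ)⁻¹ x :=
  (Complex.hasDerivAt_log (Complex.ofReal_mem_slitPlane.2 hx)).comp_ofReal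

lemma hasSum_taylor_unitBall {f : ℂ → ℂ} (hf : AnalyticOnNhd ℂ f (Metric.ball 0 1)) {z : ℂ}
    (hz : z ∈ Metric.ball (0 : ℂ) 1) :
    HasSum (fun k : ℕ => (k.factorial : ℂ)⁻¹ * iteratedDeriv k f 0 * z ^ k) (f z) := by
  have := Complex.hasSum_taylorSeries_on_ball (r := 1) (by simpa using hf.differentiableOn)
    (by simpa using hz)
  refine this.congr_fun ?_
  intro k
  simp only [sub_zero, smul_eq_mul]
  ring

lemma isTermwiseDifferentiable_mul_cpow {h l : ℂ → ℂ}
    (hh : AnalyticOnNhd ℂ h (Metric.ball 0 1)) (hl : AnalyticOnNhd ℂ l (Metric.ball 0 1)) :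
    IsTermwiseDifferentiable (fun x z => h z * (x : ℂ) ^ l z) := by
  have h0 : (0 : ℂ) ∈ Metric.ball (0 : ℂ) 1 := by simp
  have cpow_eq : ∀ x : ℝ, 0 < x → ∀ z, (x : ℂ) ^ l z = Complex.exp (Complex.log x * l z) :=
    fun x hx z => Complex.cpow_def_of_ne_zero (by exact_mod_cast hx.ne') _
  have an : ∀ {h : ℂ → ℂ}, AnalyticOnNhd ℂ h (Metric.ball 0 1) → ∀ t : ℂ,
      AnalyticOnNhd ℂ (fun z => h z * Complex.exp (t * l z)) (Metric.ball 0 1) :=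
    fun hh t z hz => (hh z hz).mul (analyticAt_const.mul (hl z hz)).cexp
  have dcoeff : ∀ {h : ℂ → ℂ}, AnalyticOnNhd ℂ h (Metric.ball 0 1) → ∀ (k : ℕ) (x : ℝ), 0 < x →
      HasDerivAt (fun x : ℝ =>
          iteratedDeriv k (fun z => h z * Complex.exp (Complex.log x * l z)) 0)
        (iteratedDeriv k (fun z => h z * l z * Complex.exp (Complex.log x * l z)) 0 * (x : ℂ)⁻¹)
        x := by
    intro h hh k x hx
    have hd := hasDerivAt_iteratedDeriv_mul_exp (hl 0 h0) k (hh 0 h0) (Complex.log x)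
    exact HasDerivAt.comp (h := fun x : ℝ => Complex.log x) x hd (hasDerivAt_clog_ofReal hx)
  have hhl : AnalyticOnNhd ℂ (fun z => h z * l z) (Metric.ball 0 1) := hh.mul hl
  refine ⟨?_, fun x k => (k.factorial : ℂ)⁻¹ *
      iteratedDeriv k (fun z => h z * Complex.exp (Complex.log x * l z)) 0,
    fun x k => (k.factorial : ℂ)⁻¹ *
      (iteratedDeriv k (fun z => h z * l z * Complex.exp (Complex.log x * l z)) 0 * (x : ℂ)⁻¹),
    fun x z => h z * l z * Complex.exp (Complex.log x * l z) * (x : ℂ)⁻¹, ?_, ?_, ?_, ?_, ?_⟩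
  · intro x hx
    simp only [cpow_eq x hx]
    exact an hh _
  · intro x hx z hz
    simp only [cpow_eq x hx]
    exact hasSum_taylor_unitBall (an hh _) hz
  · intro k x hx
    exact (dcoeff hh k x hx).const_mul _
  · intro k x hx
    have hx0 : (x : ℂ) ≠ 0 := by exact_mod_cast (ne_of_gt hx : x ≠ 0)
    exact (continuousAt_const.mul ((dcoeff hhl k x hx).continuousAt.mul
      (Complex.continuous_ofReal.continuousAt.inv₀ hx0))).continuousWithinAt
  · intro x hx z _
    have := ((hasDerivAt_clog_ofReal hx).mul_const (l z)).cexp.const_mul (h z)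
    refine (this.congr_deriv (by ring)).congr_of_eventuallyEq ?_
    filter_upwards [Ioi_mem_nhds hx] with w hw
    rw [cpow_eq w hw]
  · intro x hx z hz
    refine ((hasSum_taylor_unitBall (an hhl (Complex.log x)) hz).mul_right (x : ℂ)⁻¹).congr_fun ?_
    intro k
    ring

lemma five_add_four_mul_mem_slitPlane {z : ℂ} (hz : z ∈ Metric.ball (0 : ℂ) 1) :
    5 + 4 * z ∈ Complex.slitPlane := by
  left
  have h1 : ‖z‖ < 1 := by simpa using hz
  have h2 := (abs_le.1 (Complex.abs_re_le_norm z)).1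
  simp
  linarith

lemma analyticOnNhd_sqrt :
    AnalyticOnNhd ℂ (fun z : ℂ => (5 + 4 * z) ^ (1/2 : ℂ)) (Metric.ball 0 1) := fun _ hz =>
  AnalyticAt.cpow (analyticAt_const.add (analyticAt_const.mul analyticAt_id)) analyticAt_const
    (five_add_four_mul_mem_slitPlane hz)

lemma analyticOnNhd_lam1 : AnalyticOnNhd ℂ lam1 (Metric.ball 0 1) := fun z hz =>
  (analyticAt_const.add (analyticOnNhd_sqrt z hz)).div analyticAt_const two_ne_zero

lemma analyticOnNhd_lam2 : AnalyticOnNhd ℂ lam2 (Metric.ball 0 1) := fun z hz =>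
  (analyticAt_const.sub (analyticOnNhd_sqrt z hz)).div analyticAt_const two_ne_zero

lemma lam1_sub_lam2_ne_zero {z : ℂ} (hz : z ∈ Metric.ball (0 : ℂ) 1) :
    lam1 z - lam2 z ≠ 0 := by
  have h : lam1 z - lam2 z = (5 + 4 * z) ^ (1/2 : ℂ) := by
    unfold lam1 lam2
    ring
  rw [h, Complex.cpow_def_of_ne_zero
    (Complex.slitPlane_ne_zero (five_add_four_mul_mem_slitPlane hz))]
  exact Complex.exp_ne_zero _

lemma analyticOnNhd_cOne : AnalyticOnNhd ℂ cOne (Metric.ball 0 1) := fun z hz =>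
  (((analyticAt_id.sub analyticAt_const).div analyticAt_const three_ne_zero).sub
    (analyticOnNhd_lam2 z hz)).div
    ((analyticOnNhd_lam1 z hz).sub (analyticOnNhd_lam2 z hz)) (lam1_sub_lam2_ne_zero hz)

lemma analyticOnNhd_cTwo : AnalyticOnNhd ℂ cTwo (Metric.ball 0 1) := fun z hz =>
  (((analyticAt_id.sub analyticAt_const).div analyticAt_const three_ne_zero).neg.add
    (analyticOnNhd_lam1 z hz)).div
    ((analyticOnNhd_lam1 z hz).sub (analyticOnNhd_lam2 z hz)) (lam1_sub_lam2_ne_zero hz)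

lemma analyticOnNhd_one_add_div {l : ℂ → ℂ} (hl : AnalyticOnNhd ℂ l (Metric.ball 0 1)) :
    AnalyticOnNhd ℂ (fun z => 1 + l z / (1 - z)) (Metric.ball 0 1) := by
  intro z hz
  refine analyticAt_const.add ((hl z hz).div (analyticAt_const.sub analyticAt_id) ?_)
  intro h
  have hz1 : z = 1 := (sub_eq_zero.1 h).symm
  simp [hz1] at hz

lemma isTermwiseDifferentiable_aFun : IsTermwiseDifferentiable aFun :=
  (isTermwiseDifferentiable_mul_cpow analyticOnNhd_cOne analyticOnNhd_lam1).add
    (isTermwiseDifferentiable_mul_cpow analyticOnNhd_cTwo analyticOnNhd_lam2)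

lemma isTermwiseDifferentiable_bFun : IsTermwiseDifferentiable bFun :=
  (isTermwiseDifferentiable_mul_cpow
    (analyticOnNhd_cOne.mul (analyticOnNhd_one_add_div analyticOnNhd_lam1))
    analyticOnNhd_lam1).add
  (isTermwiseDifferentiable_mul_cpow
    (analyticOnNhd_cTwo.mul (analyticOnNhd_one_add_div analyticOnNhd_lam2))
    analyticOnNhd_lam2)

lemma hasDerivAt_affine_mul_exp_neg (a b : ℂ) (y : ℝ) :
    HasDerivAt (fun y : ℝ => (a + b * (y : ℂ)) * Complex.exp (-(y : ℂ)))
      ((b - (a + b * (y : ℂ))) * Complex.exp (-(y : ℂ))) y := by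
  have hy : HasDerivAt (fun y : ℝ => (y : ℂ)) 1 y := (hasDerivAt_id (y : ℂ)).comp_ofReal
  refine (((hy.const_mul b).const_add a).mul hy.fun_neg.cexp).congr_deriv ?_
  ring

/-- `z ↦ M(x,y,z)` is analytic on the unit disk; its power-series coefficients `g(·,·,k)` are
differentiable in `x` and `y` on `(1,∞)×(0,∞)` with continuous partial derivatives, and the
`x`- and `y`-derivatives of `M` are obtained by term-by-term differentiation. -/
theorem statement14 :
    (∀ x y : ℝ, 1 ≤ x → 0 ≤ y → ∀ z ∈ Metric.ball (0 : ℂ) 1, AnalyticAt ℂ (Mfun x y) z) ∧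
    ∃ g gx gy : ℝ → ℝ → ℕ → ℂ,
      (∀ x y : ℝ, 1 ≤ x → 0 ≤ y → ∀ z ∈ Metric.ball (0 : ℂ) 1,
        HasSum (fun k : ℕ => g x y k * z ^ k) (Mfun x y z)) ∧
      (∀ k : ℕ, ∀ x ∈ Set.Ioi (1 : ℝ), ∀ y ∈ Set.Ioi (0 : ℝ),
        HasDerivAt (fun x' => g x' y k) (gx x y k) x ∧
        HasDerivAt (fun y' => g x y' k) (gy x y k) y) ∧
      (∀ k : ℕ,
        ContinuousOn (fun p : ℝ × ℝ => gx p.1 p.2 k) (Set.Ioi 1 ×ˢ Set.Ioi 0) ∧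
        ContinuousOn (fun p : ℝ × ℝ => gy p.1 p.2 k) (Set.Ioi 1 ×ˢ Set.Ioi 0)) ∧
      (∀ x ∈ Set.Ioi (1 : ℝ), ∀ y ∈ Set.Ioi (0 : ℝ), ∀ z ∈ Metric.ball (0 : ℂ) 1,
        HasSum (fun k : ℕ => gx x y k * z ^ k) (deriv (fun x' : ℝ => Mfun x' y z) x) ∧
        HasSum (fun k : ℕ => gy x y k * z ^ k) (deriv (fun y' : ℝ => Mfun x y' z) y)) := by
  obtain ⟨ana, p, p', a', suma, dp, contp, da, suma'⟩ := isTermwiseDifferentiable_aFun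
  obtain ⟨anb, q, q', b', sumb, dq, contq, db, sumb'⟩ := isTermwiseDifferentiable_bFun
  have combine : ∀ {u v : ℕ → ℂ} {A B z : ℂ} (s t : ℂ), HasSum (fun k => u k * z ^ k) A →
      HasSum (fun k => v k * z ^ k) B →
      HasSum (fun k => (u k + v k * s) * t * z ^ k) ((A + B * s) * t) := by
    intro u v A B z s t hu hv
    refine ((hu.add (hv.mul_right s)).mul_right t).congr_fun ?_
    intro k
    ring
  refine ⟨fun x y hx _ z hz => ?_,
    fun x y k => (p x k + q x k * (y : ℂ)) * Complex.exp (-(y : ℂ)),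
    fun x y k => (p' x k + q' x k * (y : ℂ)) * Complex.exp (-(y : ℂ)),
    fun x y k => (q x k - (p x k + q x k * (y : ℂ))) * Complex.exp (-(y : ℂ)),
    fun x y hx _ z hz => ?_, fun k x hx y _ => ⟨?_, ?_⟩, fun k => ⟨?_, ?_⟩,
    fun x hx y _ z hz => ⟨?_, ?_⟩⟩
  · have hx0 : 0 < x := by linarith
    exact ((ana x hx0 z hz).add ((anb x hx0 z hz).mul analyticAt_const)).mul analyticAt_const
  · have hx0 : 0 < x := by linarith
    exact combine _ _ (suma x hx0 z hz) (sumb x hx0 z hz)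
  · have hx0 : 0 < x := zero_lt_one.trans hx
    exact ((dp k x hx0).add ((dq k x hx0).mul_const _)).mul_const _
  · exact hasDerivAt_affine_mul_exp_neg _ _ y
  · have hmaps : MapsTo Prod.fst (Ioi (1 : ℝ) ×ˢ Ioi (0 : ℝ)) (Ioi 0) :=
      fun w hw => mem_Ioi.2 (zero_lt_one.trans (mem_Ioi.1 hw.1))
    have hp := (contp k).comp continuousOn_fst hmaps
    have hq := (contq k).comp continuousOn_fst hmaps
    have hy : Continuous fun w : ℝ × ℝ => (w.2 : ℂ) := by fun_prop
    exact (hp.add (hq.mul hy.continuousOn)).mul hy.neg.cexp.continuousOn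
  · have hmaps : MapsTo Prod.fst (Ioi (1 : ℝ) ×ˢ Ioi (0 : ℝ)) (Ioi 0) :=
      fun w hw => mem_Ioi.2 (zero_lt_one.trans (mem_Ioi.1 hw.1))
    have hp : ContinuousOn (fun w : ℝ × ℝ => p w.1 k) (Ioi 1 ×ˢ Ioi 0) :=
      ContinuousOn.comp (g := fun x => p x k) (t := Ioi 0)
        (fun x hx => (dp k x hx).continuousAt.continuousWithinAt) continuousOn_fst hmaps
    have hq : ContinuousOn (fun w : ℝ × ℝ => q w.1 k) (Ioi 1 ×ˢ Ioi 0) :=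
      ContinuousOn.comp (g := fun x => q x k) (t := Ioi 0)
        (fun x hx => (dq k x hx).continuousAt.continuousWithinAt) continuousOn_fst hmaps
    have hy : Continuous fun w : ℝ × ℝ => (w.2 : ℂ) := by fun_prop
    exact (hq.sub (hp.add (hq.mul hy.continuousOn))).mul hy.neg.cexp.continuousOn
  · have hx0 : 0 < x := zero_lt_one.trans hx
    have hd : HasDerivAt (fun x' : ℝ => Mfun x' y z)
        ((a' x z + b' x z * (y : ℂ)) * Complex.exp (-(y : ℂ))) x :=
      ((da x hx0 z hz).add ((db x hx0 z hz).mul_const _)).mul_const _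
    rw [hd.deriv]
    exact combine _ _ (suma' x hx0 z hz) (sumb' x hx0 z hz)
  · have hx0 : 0 < x := zero_lt_one.trans hx
    have hd : HasDerivAt (fun y' : ℝ => Mfun x y' z) _ y :=
      hasDerivAt_affine_mul_exp_neg (aFun x z) (bFun x z) y
    rw [hd.deriv]
    refine (((sumb x hx0 z hz).sub
      ((suma x hx0 z hz).add ((sumb x hx0 z hz).mul_right (y : ℂ)))).mul_right
      (Complex.exp (-(y : ℂ)))).congr_fun ?_
    intro k
    ring
end

section
/- Let Λ(λ) = (−3+√(5+4e^λ))/2 for λ ∈ ℝ. Then for every x ≥ 0, sup_{λ∈ℝ} (λx − Λ(λ)) = x·log(2x(x+√(x²+5/4))) + 3/2 − (x+√(x²+5/4)) (with the first term interpreted as 0 when x = 0), and for every x < 0, sup_{λ∈ℝ} (λx − Λ(λ)) = +∞. -/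
open Set

/-- `Λ(λ) = (−3+√(5+4e^λ))/2`. -/
noncomputable def Lam (l : ℝ) : ℝ := (-3 + Real.sqrt (5 + 4 * Real.exp l)) / 2

open Filter Topology

lemma monotone_Lam : Monotone Lam := by
  intro a b h
  unfold Lam
  gcongr

lemma tendsto_Lam_atBot : Tendsto Lam atBot (𝓝 ((-3 + Real.sqrt 5) / 2)) := by
  have h : Tendsto (fun l : ℝ => 5 + 4 * Real.exp l) atBot (𝓝 (5 + 4 * 0)) :=
    (Real.tendsto_exp_atBot.const_mul 4).const_add 5
  simp only [mul_zero, add_zero] at h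
  exact (h.sqrt.const_add (-3)).div_const 2

lemma log_sub_log_le {a b : ℝ} (ha : 0 < a) (hb : 0 < b) :
    Real.log b - Real.log a ≤ (b - a) / a := by
  rw [← Real.log_div hb.ne' ha.ne', sub_div, div_self ha.ne']
  exact Real.log_le_sub_one_of_pos (div_pos hb ha)

/-- The tangent line inequality for `log (s ^ 2 - q ^ 2)`, a concave function of `s > q`. -/
lemma log_sq_sub_sq_sub_log_le {q s t : ℝ} (hq : 0 ≤ q) (hs : q < s) (ht : q < t) :
    Real.log (t ^ 2 - q ^ 2) - Real.log (s ^ 2 - q ^ 2) ≤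
      (t - s) * (2 * s / (s ^ 2 - q ^ 2)) := by
  have hs₁ : 0 < s - q := sub_pos.2 hs
  have ht₁ : 0 < t - q := sub_pos.2 ht
  have hs₂ : 0 < s + q := by linarith
  have ht₂ : 0 < t + q := by linarith
  have h₁ := log_sub_log_le hs₁ ht₁
  have h₂ := log_sub_log_le hs₂ ht₂
  rw [sq_sub_sq, sq_sub_sq, Real.log_mul ht₂.ne' ht₁.ne', Real.log_mul hs₂.ne' hs₁.ne']
  have h : (t - s) * (2 * s / ((s + q) * (s - q))) =
      (t - q - (s - q)) / (s - q) + (t + q - (s + q)) / (s + q) := by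
    field_simp
    ring
  rw [h]
  linarith

lemma isLUB_range_neg_Lam :
    IsLUB (Set.range fun l : ℝ => -Lam l) (3 / 2 - Real.sqrt (5 / 4)) := by
  have h4 : Real.sqrt 4 = 2 := by
    rw [show (4 : ℝ) = 2 ^ 2 by norm_num]
    exact Real.sqrt_sq (by norm_num)
  have h : (3 : ℝ) / 2 - Real.sqrt (5 / 4) = -((-3 + Real.sqrt 5) / 2) := by
    rw [Real.sqrt_div (by norm_num), h4]
    ring
  rw [h]
  exact isLUB_of_tendsto_atBot monotone_Lam.neg tendsto_Lam_atBot.neg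

lemma isGreatest_range_mul_sub_Lam {x : ℝ} (hx : 0 < x) :
    IsGreatest (Set.range fun l : ℝ => l * x - Lam l)
      (x * Real.log (2 * x * (x + Real.sqrt (x ^ 2 + 5 / 4)))
        + 3 / 2 - (x + Real.sqrt (x ^ 2 + 5 / 4))) := by
  set r := Real.sqrt (x ^ 2 + 5 / 4)
  have hr : r ^ 2 = x ^ 2 + 5 / 4 := Real.sq_sqrt (by positivity)
  have hr₀ : 0 ≤ r := Real.sqrt_nonneg _
  have hu : 0 < 2 * x * (x + r) := by positivity
  have hsq : 5 + 4 * (2 * x * (x + r)) = (2 * (x + r)) ^ 2 := by linear_combination -4 * hr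
  constructor
  · refine ⟨Real.log (2 * x * (x + r)), ?_⟩
    simp only [Lam]
    rw [Real.exp_log hu, hsq, Real.sqrt_sq (by positivity)]
    ring
  · rintro _ ⟨l, rfl⟩
    have hl := Real.exp_pos l
    have hs : Real.sqrt 5 < 2 * (x + r) :=
      (Real.sqrt_lt' (by positivity)).2 (by linarith)
    have ht : Real.sqrt 5 < Real.sqrt (5 + 4 * Real.exp l) :=
      Real.sqrt_lt_sqrt (by norm_num) (by linarith)
    have h := log_sq_sub_sq_sub_log_le (Real.sqrt_nonneg 5) hs ht
    rw [Real.sq_sqrt (by positivity), Real.sq_sqrt (by norm_num), ← hsq, add_sub_cancel_left,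
      add_sub_cancel_left, Real.log_mul (by norm_num) hl.ne',
      Real.log_mul (by norm_num) hu.ne', Real.log_exp,
      show 2 * (2 * (x + r)) / (4 * (2 * x * (x + r))) = 1 / (2 * x) by field_simp; norm_num,
      mul_one_div, le_div_iff₀ (by positivity)] at h
    simp only [Lam]
    linarith

/-- The Fenchel–Legendre transform of `Λ`: for `x ≥ 0`,
`sup_λ (λx − Λ(λ)) = x log(2x(x+√(x²+5/4))) + 3/2 − (x+√(x²+5/4))` (the supremum being
attained as a genuine least upper bound), and for `x < 0` the supremum is `+∞`
(the family is unbounded above). -/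
theorem statement19 :
    (∀ x : ℝ, 0 ≤ x →
      BddAbove (Set.range fun l : ℝ => l * x - Lam l) ∧
      (⨆ l : ℝ, (l * x - Lam l)) =
        x * Real.log (2 * x * (x + Real.sqrt (x ^ 2 + 5/4)))
          + 3/2 - (x + Real.sqrt (x ^ 2 + 5/4))) ∧
    (∀ x : ℝ, x < 0 → ¬ BddAbove (Set.range fun l : ℝ => l * x - Lam l)) := by
  refine ⟨fun x hx => ?_, fun x hx hb => ?_⟩
  · rcases hx.eq_or_lt with rfl | hx
    · have h := isLUB_range_neg_Lam
      simpa using And.intro h.bddAbove h.ciSup_eq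
    · have h := (isGreatest_range_mul_sub_Lam hx).isLUB
      exact ⟨h.bddAbove, h.ciSup_eq⟩
  · obtain ⟨M, hM⟩ := hb
    have hl : (|M + Lam 0| + 1) / x ≤ 0 := div_nonpos_of_nonneg_of_nonpos (by positivity) hx.le
    have h := hM ⟨(|M + Lam 0| + 1) / x, rfl⟩
    simp only [div_mul_cancel₀ _ hx.ne] at h
    linarith [monotone_Lam hl, le_abs_self (M + Lam 0)]
end
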